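/- (Corollary 3.3.) Let J_l := {g *_λ x^n : g ∈ ℝ[x,p]} and N_l := {f ∈ ℝ[x,p] : x^n *_λ f ∈ J_l}. Then the quotient Q := N_l/J_l is an ℝ-vector space of dimension exactly n². -/

import Mathlib

/- The Moyal product on ℝ[x,p], where x = X 0 and p = X 1 in `MvPolynomial (Fin 2) ℝ`:
   f *_λ g := Σ_{i=0}^∞ (λ^i/i!) Σ_{k=0}^i C(i,k) (−1)^k (∂_x^{i−k}∂_p^k f)·(∂_x^k ∂_p^{i−k} g).
   On polynomials only finitely many terms are nonzero, so the `finsum` below is faithful. -/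

open MvPolynomial

/-- Differentiation with respect to x (the variable `X 0`). -/
noncomputable def dX : MvPolynomial (Fin 2) ℝ → MvPolynomial (Fin 2) ℝ :=
  fun f => pderiv (0 : Fin 2) f

/-- Differentiation with respect to p (the variable `X 1`). -/
noncomputable def dP : MvPolynomial (Fin 2) ℝ → MvPolynomial (Fin 2) ℝ :=
  fun f => pderiv (1 : Fin 2) f

/-- The Moyal star product with deformation parameter `lam`. -/
noncomputable def moyal (lam : ℝ) (f g : MvPolynomial (Fin 2) ℝ) : MvPolynomial (Fin 2) ℝ :=
  ∑ᶠ i : ℕ, (lam ^ i / (i.factorial : ℝ)) •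
    ∑ k ∈ Finset.range (i + 1),
      ((i.choose k : ℝ) * (-1 : ℝ) ^ k) • (dX^[i - k] (dP^[k] f) * dX^[k] (dP^[i - k] g))

/-- The inclusion of polynomials in the single variable p into ℝ[x,p]. -/
noncomputable def toMv (q : Polynomial ℝ) : MvPolynomial (Fin 2) ℝ :=
  Polynomial.aeval (X 1 : MvPolynomial (Fin 2) ℝ) q

/-- The left ideal J_l = ℝ[x,p] *_λ x^n. -/
def Jl (lam : ℝ) (n : ℕ) : Set (MvPolynomial (Fin 2) ℝ) :=
  {f | ∃ g : MvPolynomial (Fin 2) ℝ, f = moyal lam g (X 0 ^ n)}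

/-- The normalizer N_l = {f : x^n *_λ f ∈ J_l}. -/
def Nl (lam : ℝ) (n : ℕ) : Set (MvPolynomial (Fin 2) ℝ) :=
  {f | moyal lam (X 0 ^ n) f ∈ Jl lam n}

section LinearAlgebra

universe w

variable {K : Type*} [Field K]

/-- The part of the snake lemma needed for counting dimensions of kernels. -/
theorem rank_ker_of_shortExact {A B C : Type w} [AddCommGroup A] [AddCommGroup B] [AddCommGroup C]
    [Module K A] [Module K B] [Module K C] {i : A →ₗ[K] B} {p : B →ₗ[K] C}
    (hi : Function.Injective i) (hp : Function.Surjective p) (hip : ∀ b, p b = 0 ↔ ∃ a, i a = b)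
    {α : A →ₗ[K] A} {β : B →ₗ[K] B} {γ : C →ₗ[K] C}
    (hα : ∀ a, i (α a) = β (i a)) (hγ : ∀ b, p (β b) = γ (p b))
    (sα : Function.Surjective α) (sγ : Function.Surjective γ) {a c : ℕ}
    (ra : Module.rank K (LinearMap.ker α) = a) (rc : Module.rank K (LinearMap.ker γ) = c) :
    Function.Surjective β ∧ Module.rank K (LinearMap.ker β) = (a + c : ℕ) := by
  have lift (b : B) (z : C) (hz : γ z = p b) : ∃ y, β y = b ∧ p y = z := by
    obtain ⟨y, rfl⟩ := hp z
    obtain ⟨t, ht⟩ := (hip (b - β y)).1 (by simp [hγ, hz])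
    obtain ⟨t, rfl⟩ := sα t
    refine ⟨y + i t, ?_, ?_⟩
    · rw [map_add, ← hα, ht]; abel
    · rw [map_add, (hip _).2 ⟨t, rfl⟩, add_zero]
  refine ⟨fun b => ?_, ?_⟩
  · obtain ⟨z, hz⟩ := sγ (p b)
    obtain ⟨y, hy, -⟩ := lift b z hz
    exact ⟨y, hy⟩
  · let g : LinearMap.ker β →ₗ[K] LinearMap.ker γ := p.restrict fun x hx => by
      rw [LinearMap.mem_ker] at hx ⊢; rw [← hγ, hx, map_zero]
    let h : LinearMap.ker α →ₗ[K] LinearMap.ker β := i.restrict fun x hx => by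
      rw [LinearMap.mem_ker] at hx ⊢; rw [← hα, hx, map_zero]
    have hg : Function.Surjective g := by
      rintro ⟨z, hz⟩
      obtain ⟨y, hy, hyz⟩ := lift 0 z (by simpa using hz)
      exact ⟨⟨y, hy⟩, Subtype.ext hyz⟩
    have hh : Function.Injective h := fun x y hxy =>
      Subtype.ext (hi (congrArg Subtype.val hxy))
    have hgh : LinearMap.ker g = LinearMap.range h := by
      ext ⟨y, hy⟩
      rw [LinearMap.mem_ker, LinearMap.mem_range]
      constructor
      · intro hgy
        obtain ⟨t, rfl⟩ := (hip y).1 (congrArg Subtype.val hgy)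
        exact ⟨⟨t, hi (by rw [hα, map_zero]; exact hy)⟩, rfl⟩
      · rintro ⟨t, ht⟩
        exact Subtype.ext ((hip y).2 ⟨t, congrArg Subtype.val ht⟩)
    have e := (LinearEquiv.ofInjective h hh).rank_eq
    rw [LinearMap.rank_eq_of_surjective hg, hgh, ← e, ra, rc, Nat.cast_add, add_comm]

theorem rank_ker_pow_of_surjective {A : Type*} [AddCommGroup A] [Module K A] {f : A →ₗ[K] A}
    (hf : Function.Surjective f) {d : ℕ} (hd : Module.rank K (LinearMap.ker f) = d) (n : ℕ) :
    Module.rank K (LinearMap.ker (f ^ n)) = (n * d : ℕ) := by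
  induction n with
  | zero =>
    have : LinearMap.ker (f ^ 0) = ⊥ := LinearMap.ker_id
    rw [this, rank_bot, zero_mul, Nat.cast_zero]
  | succ n ih =>
    let g : LinearMap.ker (f ^ (n + 1)) →ₗ[K] LinearMap.ker (f ^ n) := f.restrict fun x hx => by
      rw [LinearMap.mem_ker] at hx ⊢; rwa [pow_succ] at hx
    have hg : Function.Surjective g := by
      rintro ⟨z, hz⟩
      obtain ⟨y, rfl⟩ := hf z
      exact ⟨⟨y, by rw [LinearMap.mem_ker, pow_succ]; exact hz⟩, rfl⟩
    have hle : LinearMap.ker f ≤ LinearMap.ker (f ^ (n + 1)) := fun x hx => by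
      rw [LinearMap.mem_ker] at hx ⊢; rw [pow_succ, Module.End.mul_apply, hx, map_zero]
    have hk : LinearMap.ker g = (LinearMap.ker f).comap (LinearMap.ker (f ^ (n + 1))).subtype := by
      ext ⟨y, hy⟩
      exact Subtype.ext_iff
    rw [LinearMap.rank_eq_of_surjective hg, hk, (Submodule.comapSubtypeEquivOfLe hle).rank_eq, ih,
      hd, add_mul, one_mul, Nat.cast_add]

variable {V : Type*} [AddCommGroup V] [Module K V]

theorem range_le_comap_of_commute {f g : V →ₗ[K] V} (h : Commute f g) :
    LinearMap.range g ≤ (LinearMap.range g).comap f := by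
  rintro _ ⟨y, rfl⟩
  exact ⟨f y, (LinearMap.congr_fun h.eq y).symm⟩

theorem rank_ker_mapQ_range_pow {L R : V →ₗ[K] V} (h : Commute L R) (hR : Function.Injective R)
    (hL : ∀ f, ∃ g k, f = L g + R k) {u : V} (hu : u ∉ LinearMap.range R)
    (hLu : L u ∈ LinearMap.range R)
    (hker : ∀ f, L f ∈ LinearMap.range R → ∃ c : K, ∃ k, f = c • u + R k) (b : ℕ) :
    Function.Surjective ((LinearMap.range (R ^ b)).mapQ _ L
        (range_le_comap_of_commute (h.pow_right b))) ∧
      Module.rank K (LinearMap.ker ((LinearMap.range (R ^ b)).mapQ _ L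
        (range_le_comap_of_commute (h.pow_right b)))) = b := by
  induction b with
  | zero =>
    have : Subsingleton (V ⧸ LinearMap.range (R ^ 0)) := by
      rw [Submodule.Quotient.subsingleton_iff]
      exact LinearMap.range_id
    refine ⟨fun x => ⟨0, Subsingleton.elim _ _⟩, ?_⟩
    rw [Nat.cast_zero, rank_subsingleton']
  | succ b ih =>
    have base : Function.Surjective ((LinearMap.range R).mapQ _ L (range_le_comap_of_commute h)) ∧
        Module.rank K (LinearMap.ker ((LinearMap.range R).mapQ _ L
          (range_le_comap_of_commute h))) = (1 : ℕ) := by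
      constructor
      · intro x
        obtain ⟨f, rfl⟩ := Submodule.Quotient.mk_surjective _ x
        obtain ⟨g, k, rfl⟩ := hL f
        refine ⟨Submodule.Quotient.mk g, ?_⟩
        rw [Submodule.mapQ_apply, Submodule.Quotient.eq]
        exact ⟨-k, by simp⟩
      · rw [Nat.cast_one, Module.rank_eq_one_iff_finrank_eq_one]
        refine finrank_eq_one (⟨Submodule.Quotient.mk u, ?_⟩ : LinearMap.ker _) ?_ ?_
        · rw [LinearMap.mem_ker, Submodule.mapQ_apply, Submodule.Quotient.mk_eq_zero]
          exact hLu
        · intro h0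
          exact hu ((Submodule.Quotient.mk_eq_zero _).1 (congrArg Subtype.val h0))
        · rintro ⟨x, hx⟩
          obtain ⟨f, rfl⟩ := Submodule.Quotient.mk_surjective _ x
          rw [LinearMap.mem_ker, Submodule.mapQ_apply, Submodule.Quotient.mk_eq_zero] at hx
          obtain ⟨c, k, rfl⟩ := hker f hx
          refine ⟨c, Subtype.ext ?_⟩
          change Submodule.Quotient.mk (c • u) = _
          rw [Submodule.Quotient.eq]
          exact ⟨-k, by simp⟩
    have hle₁ : LinearMap.range (R ^ b) ≤ (LinearMap.range (R ^ (b + 1))).comap R := by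
      rintro _ ⟨y, rfl⟩
      exact ⟨y, by rw [pow_succ', Module.End.mul_apply]⟩
    have hle₂ : LinearMap.range (R ^ (b + 1)) ≤ (LinearMap.range R).comap LinearMap.id := by
      rintro _ ⟨y, rfl⟩
      exact ⟨(R ^ b) y, by rw [pow_succ', Module.End.mul_apply]; rfl⟩
    refine rank_ker_of_shortExact (i := Submodule.mapQ _ _ R hle₁)
      (p := Submodule.mapQ _ _ LinearMap.id hle₂) ?_ ?_ ?_ ?_ ?_ ih.1 base.1 ih.2 base.2
    · rw [injective_iff_map_eq_zero]
      intro x hx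
      obtain ⟨f, rfl⟩ := Submodule.Quotient.mk_surjective _ x
      rw [Submodule.mapQ_apply, Submodule.Quotient.mk_eq_zero] at hx
      obtain ⟨y, hy⟩ := hx
      rw [pow_succ', Module.End.mul_apply] at hy
      exact (Submodule.Quotient.mk_eq_zero _).2 ⟨y, hR hy⟩
    · intro x
      obtain ⟨f, rfl⟩ := Submodule.Quotient.mk_surjective _ x
      exact ⟨Submodule.Quotient.mk f, rfl⟩
    · intro x
      obtain ⟨f, rfl⟩ := Submodule.Quotient.mk_surjective _ x
      rw [Submodule.mapQ_apply, Submodule.Quotient.mk_eq_zero]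
      constructor
      · rintro ⟨y, hy⟩
        exact ⟨Submodule.Quotient.mk y, by rw [Submodule.mapQ_apply, hy]; rfl⟩
      · rintro ⟨y, hy⟩
        obtain ⟨y, rfl⟩ := Submodule.Quotient.mk_surjective _ y
        rw [Submodule.mapQ_apply, Submodule.Quotient.eq] at hy
        obtain ⟨z, hz⟩ := hy
        refine ⟨y - (R ^ b) z, ?_⟩
        rw [pow_succ', Module.End.mul_apply] at hz
        rw [map_sub, hz]
        simp
    · intro x
      obtain ⟨f, rfl⟩ := Submodule.Quotient.mk_surjective _ x
      simp only [Submodule.mapQ_apply]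
      rw [← Module.End.mul_apply, ← Module.End.mul_apply, h.eq]
    · intro x
      obtain ⟨f, rfl⟩ := Submodule.Quotient.mk_surjective _ x
      rfl

theorem exists_basis_ker_mapQ_range_pow {L R : V →ₗ[K] V} (h : Commute L R)
    (hR : Function.Injective R) (hL : ∀ f, ∃ g k, f = L g + R k) {u : V}
    (hu : u ∉ LinearMap.range R) (hLu : L u ∈ LinearMap.range R)
    (hker : ∀ f, L f ∈ LinearMap.range R → ∃ c : K, ∃ k, f = c • u + R k) (a b : ℕ) :
    ∃ v : Fin (a * b) → V,
      (∀ j, (L ^ a) (v j) ∈ LinearMap.range (R ^ b)) ∧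
      (∀ f, (L ^ a) f ∈ LinearMap.range (R ^ b) →
        ∃ c : Fin (a * b) → K, f - ∑ j, c j • v j ∈ LinearMap.range (R ^ b)) ∧
      (∀ c : Fin (a * b) → K, (∑ j, c j • v j) ∈ LinearMap.range (R ^ b) → c = 0) := by
  obtain ⟨hs, hr⟩ := rank_ker_mapQ_range_pow h hR hL hu hLu hker b
  have hrank := rank_ker_pow_of_surjective hs hr a
  rw [← Submodule.mapQ_pow] at hrank
  have hmem (f : V) : (L ^ a) f ∈ LinearMap.range (R ^ b) ↔ (Submodule.Quotient.mk f : V ⧸ _) ∈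
      LinearMap.ker ((LinearMap.range (R ^ b)).mapQ _ (L ^ a)
        (range_le_comap_of_commute ((h.pow_right b).pow_left a))) := by
    rw [LinearMap.mem_ker, Submodule.mapQ_apply, Submodule.Quotient.mk_eq_zero]
  have : Module.Finite K (LinearMap.ker ((LinearMap.range (R ^ b)).mapQ _ (L ^ a)
      (range_le_comap_of_commute ((h.pow_right b).pow_left a)))) :=
    Module.rank_lt_aleph0_iff.1 (hrank ▸ Cardinal.natCast_lt_aleph0)
  let B := Module.finBasisOfFinrankEq K _ (Module.finrank_eq_of_rank_eq hrank)
  choose v hv using fun j => Submodule.Quotient.mk_surjective _ (B j).1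
  have hsum (c : Fin (a * b) → K) : (Submodule.Quotient.mk (∑ j, c j • v j) : V ⧸ _) =
      ((∑ j, c j • B j : LinearMap.ker _) : V ⧸ LinearMap.range (R ^ b)) := by
    rw [← Submodule.mkQ_apply]
    simp [hv]
  refine ⟨v, fun j => ?_, fun f hf => ?_, fun c hc => ?_⟩
  · rw [hmem, hv]
    exact (B j).2
  · refine ⟨B.repr ⟨_, (hmem f).1 hf⟩, ?_⟩
    rw [← Submodule.Quotient.eq, hsum, B.sum_repr]
  · rw [← Submodule.Quotient.mk_eq_zero, hsum, Submodule.coe_eq_zero] at hc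
    funext j
    exact Fintype.linearIndependent_iff.1 B.linearIndependent c hc j

end LinearAlgebra

theorem totalDegree_pderiv_le {σ A : Type*} [CommSemiring A] (i : σ) (f : MvPolynomial σ A) :
    (pderiv i f).totalDegree ≤ f.totalDegree := by
  refine Finset.sup_le fun m hm => ?_
  rw [mem_support_iff, coeff_pderiv] at hm
  have hm' : m + Finsupp.single i 1 ∈ f.support := mem_support_iff.2 (left_ne_zero_of_mul hm)
  refine le_trans ?_ (le_totalDegree hm')
  rw [Finsupp.sum_add_index' (fun _ => rfl) fun _ _ _ => rfl]
  exact Nat.le_add_right _ _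

theorem surjective_pderiv {σ F : Type*} [Field F] [CharZero F] (i : σ) :
    Function.Surjective (pderiv i : MvPolynomial σ F → MvPolynomial σ F) := by
  intro f
  suffices f ∈ LinearMap.range (pderiv i : Derivation F _ (MvPolynomial σ F)).toLinearMap from this
  rw [f.as_sum]
  refine Submodule.sum_mem _ fun m _ => ⟨monomial (m + Finsupp.single i 1)
    (coeff m f / (m i + 1)), ?_⟩
  have : (m i + 1 : F) ≠ 0 := Nat.cast_add_one_ne_zero _
  simp [pderiv_monomial, this]

/-- The operator `x + t ∂_p`; it is left star multiplication by `x` for `t = λ`, and right star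
multiplication by `x` for `t = -λ`. -/
noncomputable def starX (t : ℝ) : MvPolynomial (Fin 2) ℝ →ₗ[ℝ] MvPolynomial (Fin 2) ℝ :=
  t • (pderiv (1 : Fin 2) : Derivation ℝ _ (MvPolynomial (Fin 2) ℝ)).toLinearMap +
    LinearMap.mulLeft ℝ (X 0)

theorem starX_apply (t : ℝ) (f : MvPolynomial (Fin 2) ℝ) :
    starX t f = t • pderiv 1 f + X 0 * f := rfl

theorem commute_pderiv_mulLeft : Commute
    (pderiv (1 : Fin 2) : Derivation ℝ _ (MvPolynomial (Fin 2) ℝ)).toLinearMap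
    (LinearMap.mulLeft ℝ (X 0)) := by
  refine LinearMap.ext fun f => ?_
  simp

theorem commute_starX (s t : ℝ) : Commute (starX s) (starX t) := by
  have h := commute_pderiv_mulLeft
  exact ((((Commute.refl _).smul_left s).smul_right t).add_right (h.smul_left s)).add_left
    ((h.symm.smul_right t).add_right (Commute.refl _))

theorem starX_eq_C {t c : ℝ} {f : MvPolynomial (Fin 2) ℝ} (h : starX t f = C c) : f = 0 := by
  by_contra hf
  have hX : X 0 * f = C c + (-t) • pderiv 1 f := by
    rw [← h, starX_apply, neg_smul]; abel
  have hdeg := congrArg totalDegree hX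
  rw [totalDegree_mul_of_isDomain (X_ne_zero _) hf, totalDegree_X] at hdeg
  have h₁ := totalDegree_add (C c) ((-t) • pderiv (1 : Fin 2) f)
  have h₂ := (totalDegree_smul_le (-t) (pderiv (1 : Fin 2) f)).trans (totalDegree_pderiv_le 1 f)
  rw [totalDegree_C] at h₁
  omega

theorem exists_eq_C_add_starX {f : MvPolynomial (Fin 2) ℝ} (hf : pderiv 1 f = 0) (t : ℝ) :
    ∃ c : ℝ, ∃ k, f = c • 1 + starX t k := by
  suffices f ∈ Submodule.span ℝ {1} ⊔ LinearMap.range (starX t) by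
    obtain ⟨y, hy, z, ⟨k, rfl⟩, rfl⟩ := Submodule.mem_sup.1 this
    obtain ⟨c, rfl⟩ := Submodule.mem_span_singleton.1 hy
    exact ⟨c, k, rfl⟩
  have hsupp : ∀ m ∈ f.support, m 1 = 0 := by
    intro m hm
    by_contra h
    have hle : Finsupp.single 1 1 ≤ m := by simpa using Nat.one_le_iff_ne_zero.2 h
    have := coeff_pderiv (i := (1 : Fin 2)) f (m - Finsupp.single 1 1)
    rw [hf, tsub_add_cancel_of_le hle, coeff_zero] at this
    have h' : (((m - Finsupp.single 1 1 : Fin 2 →₀ ℕ) 1 : ℕ) + 1 : ℝ) ≠ 0 := by positivity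
    exact mem_support_iff.1 hm ((mul_eq_zero.1 this.symm).resolve_right h')
  rw [f.as_sum]
  refine Submodule.sum_mem _ fun m hm => ?_
  by_cases h0 : m 0 = 0
  · refine Submodule.mem_sup_left (Submodule.mem_span_singleton.2 ⟨coeff m f, ?_⟩)
    have : m = 0 := Finsupp.ext fun i => by fin_cases i; exacts [h0, hsupp m hm]
    rw [this, smul_eq_C_mul, mul_one]
    rfl
  · refine Submodule.mem_sup_right ⟨monomial (m - Finsupp.single 0 1) (coeff m f), ?_⟩
    have hle : Finsupp.single 0 1 ≤ m := by simpa using Nat.one_le_iff_ne_zero.2 h0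
    rw [starX_apply, pderiv_monomial, X, monomial_mul, add_tsub_cancel_of_le hle]
    simp [hsupp m hm]

theorem starX_eq_starX_add (s t : ℝ) (f : MvPolynomial (Fin 2) ℝ) :
    starX s f = starX t f + (s - t) • pderiv 1 f := by
  rw [starX_apply, starX_apply, sub_smul]; abel

theorem iterate_dX_X_pow (i n : ℕ) :
    dX^[i] (X 0 ^ n : MvPolynomial (Fin 2) ℝ) = (n.descFactorial i : ℝ) • X 0 ^ (n - i) := by
  induction i with
  | zero => simp
  | succ i ih =>
    rw [Function.iterate_succ_apply', ih, dX, Derivation.map_smul, pderiv_pow, pderiv_X_self,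
      Nat.descFactorial_succ, mul_one, Nat.sub_sub, Nat.cast_mul, ← nsmul_eq_mul,
      ← Nat.cast_smul_eq_nsmul ℝ, smul_smul, mul_comm (n.descFactorial i : ℝ)]

theorem iterate_dX_zero (i : ℕ) : dX^[i] 0 = 0 :=
  Function.iterate_fixed (f := dX) (map_zero (pderiv (0 : Fin 2))) i

theorem iterate_dP_X_pow (i n : ℕ) (hi : i ≠ 0) : dP^[i] (X 0 ^ n : MvPolynomial (Fin 2) ℝ) = 0 := by
  obtain ⟨i, rfl⟩ := Nat.exists_eq_succ_of_ne_zero hi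
  have : dP (X 0 ^ n : MvPolynomial (Fin 2) ℝ) = 0 := by simp [dP]
  rw [Function.iterate_succ_apply, this]
  exact Function.iterate_fixed (f := dP) (map_zero (pderiv (1 : Fin 2))) i

theorem starX_pow_apply (t : ℝ) (n : ℕ) (f : MvPolynomial (Fin 2) ℝ) :
    (starX t ^ n) f = ∑ᶠ i : ℕ, (n.choose i * t ^ i : ℝ) • (X 0 ^ (n - i) * dP^[i] f) := by
  rw [finsum_eq_sum_of_support_subset (s := Finset.range (n + 1))]
  · rw [starX, ((commute_pderiv_mulLeft).smul_left t).add_pow, LinearMap.sum_apply]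
    refine Finset.sum_congr rfl fun i _ => ?_
    rw [(commute_pderiv_mulLeft.smul_left t).pow_pow, smul_pow, LinearMap.pow_mulLeft,
      mul_smul_comm, smul_mul_assoc, LinearMap.smul_apply, ← (Nat.cast_commute _ _).eq,
      Module.End.mul_apply, Module.End.mul_apply, Module.End.natCast_apply, Module.End.pow_apply,
      LinearMap.mulLeft_apply, ← Nat.cast_smul_eq_nsmul ℝ, smul_smul, mul_comm (t ^ i)]
    congr 2
  · intro i hi
    by_contra h
    refine hi ?_
    simp only [Finset.coe_range, Set.mem_Iio, not_lt] at h
    simp [Nat.choose_eq_zero_of_lt h]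

theorem moyal_coeff (lam : ℝ) (n i : ℕ) :
    lam ^ i / (i.factorial : ℝ) * n.descFactorial i = n.choose i * lam ^ i := by
  have : (i.factorial : ℝ) ≠ 0 := by positivity
  rw [Nat.descFactorial_eq_factorial_mul_choose, Nat.cast_mul]
  field_simp

theorem moyal_X_pow_right (lam : ℝ) (n : ℕ) (f : MvPolynomial (Fin 2) ℝ) :
    moyal lam f (X 0 ^ n) = (starX (-lam) ^ n) f := by
  rw [moyal, starX_pow_apply]
  refine finsum_congr fun i => ?_
  rw [Finset.sum_eq_single i]
  · rw [Nat.sub_self, Function.iterate_zero_apply, Function.iterate_zero_apply, iterate_dX_X_pow,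
      mul_smul_comm, smul_smul, smul_smul, neg_pow, mul_comm (X 0 ^ _)]
    congr 1
    rw [Nat.choose_self, Nat.cast_one, one_mul, mul_left_comm, ← moyal_coeff]
    ring
  · intro k hk hki
    have : i - k ≠ 0 := by grind
    rw [iterate_dP_X_pow _ _ this, iterate_dX_zero, mul_zero, smul_zero]
  · simp

theorem moyal_X_pow_left (lam : ℝ) (n : ℕ) (f : MvPolynomial (Fin 2) ℝ) :
    moyal lam (X 0 ^ n) f = (starX lam ^ n) f := by
  rw [moyal, starX_pow_apply]
  refine finsum_congr fun i => ?_
  rw [Finset.sum_eq_single 0]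
  · rw [Nat.sub_zero, Function.iterate_zero_apply, Function.iterate_zero_apply, iterate_dX_X_pow,
      smul_mul_assoc, smul_smul, smul_smul]
    congr 1
    simpa using moyal_coeff lam n i
  · intro k hk hki
    rw [iterate_dP_X_pow _ _ hki, iterate_dX_zero, zero_mul, smul_zero]
  · simp

/-- Corollary 3.3: the quotient Q = N_l/J_l is an ℝ-vector space of
dimension exactly n²; i.e. there are n² elements of N_l which span N_l modulo J_l and are
linearly independent modulo J_l. -/
theorem corollary_3_3 (lam : ℝ) (hlam : lam ≠ 0) (n : ℕ) (hn : 1 ≤ n) :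
    ∃ b : Fin (n ^ 2) → MvPolynomial (Fin 2) ℝ,
      (∀ j, b j ∈ Nl lam n) ∧
      (∀ f ∈ Nl lam n, ∃ c : Fin (n ^ 2) → ℝ, f - ∑ j, c j • b j ∈ Jl lam n) ∧
      (∀ c : Fin (n ^ 2) → ℝ, (∑ j, c j • b j) ∈ Jl lam n → c = 0) := by
  have hJ (f : MvPolynomial (Fin 2) ℝ) :
      f ∈ Jl lam n ↔ f ∈ LinearMap.range (starX (-lam) ^ n) := by
    simp only [Jl, Set.mem_ofPred_eq, moyal_X_pow_right, LinearMap.mem_range, eq_comm]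
  have hN (f : MvPolynomial (Fin 2) ℝ) :
      f ∈ Nl lam n ↔ (starX lam ^ n) f ∈ LinearMap.range (starX (-lam) ^ n) := by
    rw [← hJ, ← moyal_X_pow_left]
    rfl
  simp only [hN, hJ]
  rw [sq n]
  have h2 : lam - -lam ≠ 0 := by simpa [← two_mul] using hlam
  refine exists_basis_ker_mapQ_range_pow (u := 1) (commute_starX _ _) ?_ ?_ ?_ ?_ ?_ n n
  · rw [injective_iff_map_eq_zero]
    exact fun f hf => starX_eq_C (c := 0) (by rw [hf, C_0])
  · intro f
    obtain ⟨g, hg⟩ := surjective_pderiv (1 : Fin 2) ((lam - -lam)⁻¹ • f)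
    refine ⟨g, -g, ?_⟩
    rw [starX_eq_starX_add lam (-lam), hg, smul_inv_smul₀ h2, map_neg]
    abel
  · rintro ⟨f, hf⟩
    have := starX_eq_C (c := 1) (hf.trans C_1.symm)
    simp [this] at hf
  · exact ⟨1, by simp [starX_apply]⟩
  · rintro f ⟨k, hk⟩
    obtain ⟨g, hg⟩ := surjective_pderiv (1 : Fin 2) ((lam - -lam)⁻¹ • (k - f))
    have hR : starX (-lam) (pderiv 1 g) = pderiv 1 f := by
      rw [hg, map_smul, map_sub, hk, starX_eq_starX_add lam (-lam), add_sub_cancel_left,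
        inv_smul_smul₀ h2]
    have h0 : pderiv 1 (f - starX (-lam) g) = 0 := by
      rw [map_sub, ← hR, starX_apply, starX_apply, map_add, Derivation.map_smul, pderiv_mul,
        pderiv_X_of_ne (by decide)]
      simp
    obtain ⟨c, k, hk⟩ := exists_eq_C_add_starX h0 (-lam)
    exact ⟨c, k + g, by rw [map_add, ← add_assoc, ← hk, sub_add_cancel]⟩
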